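/- arXiv:1905.00853 — 3 statements merged into one kernel-verified Lean document; each statement's English description precedes it below -/
import Mathlib

section
/- Consider an n-buyer second-price auction with interdependent valuations v : Fin n → Fin n → ℝ, with ties broken in favor of the highest-index buyer. Fix a buyer i that is not the highest-indexed buyer, and a real β ≥ 0 such that v i i − β ≤ v i j for every buyer j > i. Suppose the strategy sets are: S_j a nonempty subset of [0, β] for every j < i, and S_j = [0,∞) for every j > i. Then every bid p > β of buyer i is weakly dominated, relative to (S_j)_{j≠i}, by the bid β. -/
/-- The winner of the auction: among the buyers with maximal bid, the winner is the one
with the highest index. -/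
noncomputable def winnerHigh {n : ℕ} (b : Fin (n + 1) → ℝ) : Fin (n + 1) :=
  (Finset.univ.filter fun i => ∀ j, b j ≤ b i).max' (by
    obtain ⟨i, -, hi⟩ := Finset.exists_max_image (Finset.univ : Finset (Fin (n + 1))) b
      ⟨0, Finset.mem_univ 0⟩
    exact ⟨i, Finset.mem_filter.mpr ⟨Finset.mem_univ i, fun j => hi j (Finset.mem_univ j)⟩⟩)

/-- The maximum bid among the buyers other than `w`. -/
noncomputable def secondPrice {n : ℕ} (b : Fin (n + 1) → ℝ) (w : Fin (n + 1)) : ℝ :=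
  if h : (Finset.univ.erase w).Nonempty then (Finset.univ.erase w).sup' h b else 0

/-- Buyer `i`'s utility in the second-price auction with interdependent valuations `v`
(ties broken in favor of the highest index): if `i` wins it gets `v i i` minus the
maximum bid of the other buyers, and if `j ≠ i` wins then buyer `i` gets `v i j`. -/
noncomputable def utilSPHigh {n : ℕ} (v : Fin (n + 1) → Fin (n + 1) → ℝ) (i : Fin (n + 1))
    (b : Fin (n + 1) → ℝ) : ℝ :=
  if i = winnerHigh b then v i (winnerHigh b) - secondPrice b (winnerHigh b)
  else v i (winnerHigh b)

/-- `s'` weakly dominates `s` for buyer `i` (with utility `u`) relative to the strategy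
sets `S j` of the opponents `j ≠ i`. -/
def WeaklyDominates {n : ℕ} (u : (Fin (n + 1) → ℝ) → ℝ) (i : Fin (n + 1))
    (S : Fin (n + 1) → Set ℝ) (s' s : ℝ) : Prop :=
  (∀ b : Fin (n + 1) → ℝ, (∀ j, j ≠ i → b j ∈ S j) →
    u (Function.update b i s) ≤ u (Function.update b i s')) ∧
  (∃ b : Fin (n + 1) → ℝ, (∀ j, j ≠ i → b j ∈ S j) ∧
    u (Function.update b i s) < u (Function.update b i s'))

theorem winnerHigh_eq_iff {n : ℕ} (b : Fin (n + 1) → ℝ) (w : Fin (n + 1)) :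
    winnerHigh b = w ↔ (∀ j, b j ≤ b w) ∧ ∀ k, w < k → b k < b w := by
  unfold winnerHigh
  rw [Finset.max'_eq_iff]
  simp only [Finset.mem_filter, Finset.mem_univ, true_and]
  refine and_congr_right fun hw => ⟨fun h k hk => ?_, fun h k hk => ?_⟩
  · by_contra! hle
    exact absurd (h k fun j => (hw j).trans hle) hk.not_ge
  · by_contra! hlt
    exact absurd (hk w) (h k hlt).not_ge

theorem le_secondPrice {n : ℕ} (b : Fin (n + 1) → ℝ) {w j : Fin (n + 1)} (h : j ≠ w) :
    b j ≤ secondPrice b w := by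
  have hj : j ∈ Finset.univ.erase w := by simp [h]
  rw [secondPrice, dif_pos ⟨j, hj⟩]
  exact Finset.le_sup' b hj

theorem secondPrice_update {n : ℕ} (b : Fin (n + 1) → ℝ) (w : Fin (n + 1)) (s : ℝ) :
    secondPrice (Function.update b w s) w = secondPrice b w := by
  unfold secondPrice
  split_ifs with h
  · exact Finset.sup'_congr h rfl fun j hj =>
      Function.update_of_ne (Finset.ne_of_mem_erase hj) _ _
  · rfl

theorem utilSPHigh_of_win {n : ℕ} (v : Fin (n + 1) → Fin (n + 1) → ℝ) {i : Fin (n + 1)}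
    {b : Fin (n + 1) → ℝ} (h : winnerHigh b = i) :
    utilSPHigh v i b = v i i - secondPrice b i := by
  simp [utilSPHigh, h]

theorem utilSPHigh_of_lose {n : ℕ} (v : Fin (n + 1) → Fin (n + 1) → ℝ) {i j : Fin (n + 1)}
    {b : Fin (n + 1) → ℝ} (h : winnerHigh b = j) (hj : j ≠ i) :
    utilSPHigh v i b = v i j := by
  simp [utilSPHigh, h, hj.symm]

/-- A buyer who wins against `i` still wins when `i` lowers its bid. -/
theorem winnerHigh_update_of_le {n : ℕ} {b : Fin (n + 1) → ℝ} {i j : Fin (n + 1)} {s p : ℝ}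
    (hsp : s ≤ p) (hj : j ≠ i) (h : winnerHigh (Function.update b i p) = j) :
    winnerHigh (Function.update b i s) = j := by
  rw [winnerHigh_eq_iff] at h ⊢
  obtain ⟨h1, h2⟩ := h
  rw [Function.update_of_ne hj] at h1 h2 ⊢
  have hle : ∀ k, Function.update b i s k ≤ Function.update b i p k := fun k =>
    update_le_update_iff.mpr ⟨hsp, fun _ _ => le_rfl⟩ k
  exact ⟨fun k => (hle k).trans (h1 k), fun k hk => (hle k).trans_lt (h2 k hk)⟩

/-- In a second-price auction with interdependent valuations (ties broken in favor of
the highest index), let `i` be a buyer that is not the highest-indexed one, and `β ≥ 0`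
with `v i i - β ≤ v i j` for every `j > i`. If the strategy set of each `j < i` is a
nonempty subset of `[0, β]` and that of each `j > i` is `[0, ∞)`, then every bid
`p > β` of buyer `i` is weakly dominated by the bid `β`. -/
theorem stmt1 (n : ℕ) (v : Fin (n + 1) → Fin (n + 1) → ℝ) (i : Fin (n + 1))
    (hi : i ≠ Fin.last n) (β : ℝ) (hβ : 0 ≤ β)
    (hv : ∀ j, i < j → v i i - β ≤ v i j)
    (S : Fin (n + 1) → Set ℝ)
    (hSlt : ∀ j, j < i → (S j).Nonempty ∧ S j ⊆ Set.Icc 0 β)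
    (hSgt : ∀ j, i < j → S j = Set.Ici 0)
    (p : ℝ) (hp : β < p) :
    WeaklyDominates (utilSPHigh v i) i S β p := by
  constructor
  · intro b hb
    obtain hw | hw := eq_or_ne (winnerHigh (Function.update b i p)) i
    · rw [utilSPHigh_of_win v hw, secondPrice_update]
      obtain ⟨j, hj⟩ : ∃ j, winnerHigh (Function.update b i β) = j := ⟨_, rfl⟩
      obtain rfl | hji := eq_or_ne j i
      · rw [utilSPHigh_of_win v hj, secondPrice_update]
      · rw [utilSPHigh_of_lose v hj hji]
        obtain ⟨h1, h2⟩ := (winnerHigh_eq_iff _ _).mp hj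
        rw [Function.update_of_ne hji] at h1 h2
        have hβj := h1 i
        rw [Function.update_self] at hβj
        have hij : i < j := by
          refine lt_of_le_of_ne (le_of_not_gt fun hlt => ?_) hji.symm
          have hlt' := h2 i hlt
          rw [Function.update_self] at hlt'
          exact absurd ((hSlt j hlt).2 (hb j hji)).2 hlt'.not_ge
        linarith [hv j hij, le_secondPrice b hji]
    · rw [utilSPHigh_of_lose v rfl hw,
        utilSPHigh_of_lose v (winnerHigh_update_of_le hp.le hw rfl) hw]
  · have hlast : i < Fin.last n := Fin.lt_last_iff_ne_last.mpr hi
    choose a ha using fun j (hj : j < i) => (hSlt j hj).1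
    let b : Fin (n + 1) → ℝ := fun j => if h : j < i then a j h else (β + p) / 2
    have hbm : ∀ j, j ≠ i → b j ∈ S j := by
      intro j hj
      by_cases h : j < i
      · simpa [b, h] using ha j h
      · have hij : i < j := lt_of_le_of_ne (not_lt.mp h) hj.symm
        simp only [b, h, dite_false, hSgt j hij, Set.mem_Ici]
        linarith
    have hble : ∀ j, b j ≤ (β + p) / 2 := by
      intro j
      by_cases h : j < i
      · have := ((hSlt j h).2 (ha j h)).2
        simp only [b, h, dite_true]
        linarith
      · simp [b, h]
    have hbl : b (Fin.last n) = (β + p) / 2 := by simp [b, hlast.not_gt]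
    refine ⟨b, hbm, ?_⟩
    have hwp : winnerHigh (Function.update b i p) = i := by
      rw [winnerHigh_eq_iff]
      simp only [Function.update_self]
      refine ⟨fun j => ?_, fun j hj => ?_⟩
      · obtain rfl | hj := eq_or_ne j i
        · simp
        · rw [Function.update_of_ne hj]
          linarith [hble j]
      · rw [Function.update_of_ne hj.ne']
        linarith [hble j]
    have hwβ : winnerHigh (Function.update b i β) = Fin.last n := by
      rw [winnerHigh_eq_iff, Function.update_of_ne hlast.ne', hbl]
      refine ⟨fun j => ?_, fun j hj => absurd (Fin.le_last j) hj.not_ge⟩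
      obtain rfl | hj := eq_or_ne j i
      · rw [Function.update_self]
        linarith
      · rw [Function.update_of_ne hj]
        exact hble j
    rw [utilSPHigh_of_win v hwp, secondPrice_update, utilSPHigh_of_lose v hwβ hlast.ne']
    have := le_secondPrice b hlast.ne'
    linarith [hv _ hlast]
end

section
/- Let n ≥ 2 and consider an n-buyer first-price auction with interdependent valuations v : Fin n → Fin n → ℝ, with ties broken in favor of the lowest-index buyer. Fix a buyer i and set β := max over j ≠ i of (v i i − v i j), and assume β ≥ 0. Then, relative to the strategy sets S_j = [0,∞) for every buyer j ≠ i, every bid p > β of buyer i is weakly dominated by the bid β. -/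
/-- The winner of the auction: among the buyers with maximal bid, the winner is the one
with the lowest index. -/
noncomputable def winnerLow {n : ℕ} (b : Fin (n + 1) → ℝ) : Fin (n + 1) :=
  (Finset.univ.filter fun i => ∀ j, b j ≤ b i).min' (by
    obtain ⟨i, -, hi⟩ := Finset.exists_max_image (Finset.univ : Finset (Fin (n + 1))) b
      ⟨0, Finset.mem_univ 0⟩
    exact ⟨i, Finset.mem_filter.mpr ⟨Finset.mem_univ i, fun j => hi j (Finset.mem_univ j)⟩⟩)

/-- Buyer `i`'s utility in the first-price auction with interdependent valuations `v`:
if `i` wins it gets `v i i` minus its own bid, and if `j ≠ i` wins then buyer `i`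
gets `v i j`. -/
noncomputable def utilFP {n : ℕ} (v : Fin (n + 1) → Fin (n + 1) → ℝ) (i : Fin (n + 1))
    (b : Fin (n + 1) → ℝ) : ℝ :=
  if i = winnerLow b then v i (winnerLow b) - b (winnerLow b)
  else v i (winnerLow b)

lemma le_winnerLow {n : ℕ} (b : Fin (n + 1) → ℝ) (j : Fin (n + 1)) :
    b j ≤ b (winnerLow b) := by
  have h := Finset.min'_mem (Finset.univ.filter fun i => ∀ j, b j ≤ b i) (by
    obtain ⟨i, -, hi⟩ := Finset.exists_max_image (Finset.univ : Finset (Fin (n + 1))) b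
      ⟨0, Finset.mem_univ 0⟩
    exact ⟨i, Finset.mem_filter.mpr ⟨Finset.mem_univ i, fun j => hi j (Finset.mem_univ j)⟩⟩)
  exact (Finset.mem_filter.mp h).2 j

lemma winnerLow_le {n : ℕ} {b : Fin (n + 1) → ℝ} {k : Fin (n + 1)} (hk : ∀ j, b j ≤ b k) :
    winnerLow b ≤ k :=
  Finset.min'_le _ _ (Finset.mem_filter.mpr ⟨Finset.mem_univ k, hk⟩)

/-- A losing buyer who lowers its bid does not change the winner. -/
lemma winnerLow_update_of_lt {n : ℕ} (b : Fin (n + 1) → ℝ) {i : Fin (n + 1)} {s p : ℝ}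
    (hsp : s < p) (hi : i ≠ winnerLow (Function.update b i p)) :
    winnerLow (Function.update b i s) = winnerLow (Function.update b i p) := by
  set w := winnerLow (Function.update b i p) with hw
  have hmax : ∀ j, Function.update b i p j ≤ b w := fun j => by
    simpa [← hw, Function.update_of_ne hi.symm] using le_winnerLow (Function.update b i p) j
  have hpw : p ≤ b w := by simpa using hmax i
  have hle : ∀ j, j ≠ i → b j ≤ b w := fun j hj => by
    simpa [Function.update_of_ne hj] using hmax j
  apply le_antisymm
  · apply winnerLow_le
    intro j
    rw [Function.update_of_ne hi.symm]
    by_cases hj : j = i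
    · subst hj
      simpa using hsp.le.trans hpw
    · simpa [Function.update_of_ne hj] using hle j hj
  · have hk := le_winnerLow (Function.update b i s) w
    set k := winnerLow (Function.update b i s)
    rw [Function.update_of_ne hi.symm] at hk
    have hki : k ≠ i := by
      intro h
      rw [h, Function.update_self] at hk
      linarith
    rw [Function.update_of_ne hki] at hk
    apply winnerLow_le
    intro j
    rw [Function.update_of_ne hki]
    exact (hmax j).trans hk

/-- Bidding at least every loss `v i i - v i j` guarantees `v i i` minus the bid. -/
lemma sub_le_utilFP_update {n : ℕ} {v : Fin (n + 1) → Fin (n + 1) → ℝ} {i : Fin (n + 1)} {s : ℝ}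
    (hs : ∀ j, j ≠ i → v i i - v i j ≤ s) (b : Fin (n + 1) → ℝ) :
    v i i - s ≤ utilFP v i (Function.update b i s) := by
  unfold utilFP
  split_ifs with h
  · rw [← h, Function.update_self]
  · have := hs _ (Ne.symm h)
    linarith

lemma utilFP_update_of_eq {n : ℕ} (v : Fin (n + 1) → Fin (n + 1) → ℝ) {i : Fin (n + 1)} {p : ℝ}
    {b : Fin (n + 1) → ℝ} (h : i = winnerLow (Function.update b i p)) :
    utilFP v i (Function.update b i p) = v i i - p := by
  rw [utilFP, if_pos h, ← h, Function.update_self]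

/-- In a first-price auction with interdependent valuations among `n + 2 ≥ 2` buyers
(ties broken in favor of the lowest index), if `β = max_{j ≠ i} (v i i - v i j) ≥ 0`,
then relative to the strategy sets `S j = [0, ∞)` every bid `p > β` of buyer `i`
is weakly dominated by the bid `β`. -/
theorem stmt3 (n : ℕ) (v : Fin (n + 2) → Fin (n + 2) → ℝ) (i : Fin (n + 2)) (β : ℝ)
    (hβdef : IsGreatest ((fun j => v i i - v i j) '' {j | j ≠ i}) β) (hβ : 0 ≤ β)
    (p : ℝ) (hp : β < p) :
    WeaklyDominates (utilFP v i) i (fun _ => Set.Ici (0 : ℝ)) β p := by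
  have hs : ∀ j, j ≠ i → v i i - v i j ≤ β := fun j hj => hβdef.2 ⟨j, hj, rfl⟩
  refine ⟨fun b _ => ?_, fun _ => 0, fun _ _ => Set.mem_Ici.mpr le_rfl, ?_⟩
  · have hge := sub_le_utilFP_update hs b
    by_cases h : i = winnerLow (Function.update b i p)
    · rw [utilFP_update_of_eq v h]
      linarith
    · have hw := winnerLow_update_of_lt b hp h
      rw [utilFP, utilFP, hw, if_neg h, if_neg h]
  · have hge := sub_le_utilFP_update hs (fun _ => 0)
    have h : i = winnerLow (Function.update (fun _ => (0 : ℝ)) i p) := by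
      by_contra hne
      have hle := le_winnerLow (Function.update (fun _ => (0 : ℝ)) i p) i
      rw [Function.update_self, Function.update_of_ne (Ne.symm hne)] at hle
      linarith
    rw [utilFP_update_of_eq v h]
    linarith
end

section
/- In the specific 3-buyer second-price auction with interdependent valuations given by v 1 1 = 2, v 1 2 = 1, v 1 3 = 0; v 2 1 = 0, v 2 2 = 4, v 2 3 = 1; v 3 1 = 0, v 3 2 = 1, v 3 3 = 6 (ties broken in favor of the lowest-index buyer), with strategy sets S_2 = [0,4] \ [1,2] for Buyer 2 and S_3 = [0,∞) for Buyer 3: every bid x ∈ [1,2) of Buyer 1 is weakly dominated, relative to (S_2, S_3), by the bid 2. -/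
/-- Buyer `i`'s utility in the second-price auction with interdependent valuations `v`:
if `i` wins it gets `v i i` minus the maximum bid of the other buyers, and if `j ≠ i`
wins then buyer `i` gets `v i j`. -/
noncomputable def utilSP {n : ℕ} (v : Fin (n + 1) → Fin (n + 1) → ℝ) (i : Fin (n + 1))
    (b : Fin (n + 1) → ℝ) : ℝ :=
  if i = winnerLow b then v i (winnerLow b) - secondPrice b (winnerLow b)
  else v i (winnerLow b)

/-- The specific interdependent valuations: buyers `0, 1, 2` stand for Buyers `1, 2, 3`;
`v 0 = (2, 1, 0)`, `v 1 = (0, 4, 1)`, `v 2 = (0, 1, 6)`. -/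
noncomputable def vA : Fin 3 → Fin 3 → ℝ := ![![2, 1, 0], ![0, 4, 1], ![0, 1, 6]]

theorem winnerLow_eq {n : ℕ} {b : Fin (n + 1) → ℝ} {w : Fin (n + 1)}
    (hmax : ∀ j, b j ≤ b w) (hlow : ∀ j < w, b j < b w) : winnerLow b = w := by
  refine le_antisymm (Finset.min'_le _ _ (by simpa using hmax)) ?_
  refine Finset.le_min' _ _ _ fun j hj => ?_
  by_contra! hjw
  exact (hlow j hjw).not_ge ((Finset.mem_filter.mp hj).2 w)

theorem secondPrice_three_zero (b : Fin 3 → ℝ) : secondPrice b 0 = max (b 1) (b 2) := by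
  have h : (Finset.univ.erase (0 : Fin 3)) = {1, 2} := by decide
  simp [secondPrice, h]

theorem utilSP_vA_zero (b : Fin 3 → ℝ) :
    utilSP vA 0 b =
      if b 1 ≤ b 0 ∧ b 2 ≤ b 0 then 2 - max (b 1) (b 2) else if b 2 ≤ b 1 then 1 else 0 := by
  split_ifs with h₀ h₁
  · have hw : winnerLow b = 0 :=
      winnerLow_eq (by simp [Fin.forall_fin_succ, h₀]) (by simp)
    simp [utilSP, hw, secondPrice_three_zero, vA]
  · have h : b 0 < b 1 := by grind
    have hw : winnerLow b = 1 :=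
      winnerLow_eq (by simp [Fin.forall_fin_succ, h₁, h.le]) (by simp [h])
    simp [utilSP, hw, vA]
  · have h : b 0 < b 2 := by grind
    have h' : b 1 < b 2 := not_le.mp h₁
    have hw : winnerLow b = 2 :=
      winnerLow_eq (by simp [Fin.forall_fin_succ, h'.le, h.le])
        (by simp [Fin.forall_fin_succ, h, h'])
    simp [utilSP, hw, vA]

/-- In the specific 3-buyer second-price auction `vA` (ties broken in favor of the lowest
index), with strategy sets `S 1 = [0, 4] \ [1, 2]` for Buyer 2 and `S 2 = [0, ∞)` for
Buyer 3: every bid `x ∈ [1, 2)` of Buyer 1 (index 0) is weakly dominated by the bid `2`.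
(The strategy set at index 0 is irrelevant for dominance for buyer 0.) -/
theorem stmt7 :
    ∀ x ∈ Set.Ico (1 : ℝ) 2,
      WeaklyDominates (utilSP vA 0) 0
        ![Set.Ici (0 : ℝ), Set.Icc (0 : ℝ) 4 \ Set.Icc 1 2, Set.Ici (0 : ℝ)] 2 x := by
  rintro x ⟨hx₁, hx₂⟩
  refine ⟨fun b hb => ?_, ![0, 0, (x + 2) / 2], fun j hj => ?_, ?_⟩
  · have hb₁ : b 1 ∈ Set.Icc (0 : ℝ) 4 \ Set.Icc 1 2 := hb 1 (by decide)
    simp only [Set.mem_sdiff, Set.mem_Icc] at hb₁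
    simp only [utilSP_vA_zero, Function.update_self, ne_eq, one_ne_zero, not_false_eq_true,
      Function.update_of_ne, Fin.reduceEq]
    grind
  · fin_cases j
    · exact absurd rfl hj
    · simp
    · simp
      linarith
  · simp only [utilSP_vA_zero, Function.update_self, ne_eq, one_ne_zero, not_false_eq_true,
      Function.update_of_ne, Fin.reduceEq, Matrix.cons_val]
    grind
end
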